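/- Let k ≥ 10 and n = 2k+1. Let S_{k+1}×S_k denote the subgroup of S_{2k+1} of permutations mapping the block {1,…,k+1} to itself, and let A_{k+1}×A_k denote the subgroup of those permutations whose restrictions to {1,…,k+1} and to {k+2,…,2k+1} are both even. Then for every subgroup G with A_{k+1}×A_k < G ≤ S_{k+1}×S_k (strict containment of A_{k+1}×A_k in G), the permutation character of S_{2k+1} on the cosets of G is multiplicity-free. -/

import Mathlib

/-- The permutation character of `G` on the cosets of `H` is multiplicity-free:
every irreducible complex representation of `G` has at most a one-dimensional
subspace of `H`-fixed vectors. -/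
noncomputable def IsMultFree {G : Type} [Group G] (H : Subgroup G) : Prop :=
  ∀ V : FDRep ℂ G, CategoryTheory.Simple V →
    Module.finrank ℂ (Representation.invariants (V.ρ.comp H.subtype)) ≤ 1

/-- The subgroup of permutations of `α` mapping the set defined by `p` to itself. -/
def blockStab {α : Type*} (p : α → Prop) : Subgroup (Equiv.Perm α) where
  carrier := {g | ∀ i : α, p i ↔ p (g i)}
  one_mem' := by intro i; simp
  mul_mem' := by
    intro a b ha hb i
    simpa [Equiv.Perm.mul_apply] using (hb i).trans (ha (b i))
  inv_mem' := by
    intro g hg i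
    simpa using (hg (g⁻¹ i)).symm

/-- Restriction of a block-preserving permutation to the block `{i // p i}`. -/
def restrictBlock {α : Type*} (p : α → Prop) : blockStab p →* Equiv.Perm {i // p i} where
  toFun g := Equiv.Perm.subtypePerm g.1 (fun i => (g.2 i).symm)
  map_one' := by
    ext i
    simp [Equiv.Perm.subtypePerm]
  map_mul' a b := by
    ext i
    simp [Equiv.Perm.subtypePerm, Equiv.Perm.mul_apply]

/-- Restriction of a block-preserving permutation to the complementary block `{i // ¬ p i}`. -/
def restrictCoblock {α : Type*} (p : α → Prop) : blockStab p →* Equiv.Perm {i // ¬ p i} where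
  toFun g := Equiv.Perm.subtypePerm g.1 (fun i => not_congr (g.2 i).symm)
  map_one' := by
    ext i
    simp [Equiv.Perm.subtypePerm]
  map_mul' a b := by
    ext i
    simp [Equiv.Perm.subtypePerm, Equiv.Perm.mul_apply]

/-- The subgroup of permutations of `α` mapping the set defined by `p` to itself and
restricting to even permutations of both `{i // p i}` and its complement. -/
def evenEven {α : Type*} [Fintype α] [DecidableEq α] (p : α → Prop) [DecidablePred p] :
    Subgroup (Equiv.Perm α) :=
  ((Equiv.Perm.sign.comp (restrictBlock p)).ker ⊓
      (Equiv.Perm.sign.comp (restrictCoblock p)).ker).map (blockStab p).subtype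

/-- An invariant subspace of a simple representation is trivial or everything. -/
theorem FDRep.eq_bot_or_eq_top_of_simple {G : Type} [Group G] (V : FDRep ℂ G)
    [CategoryTheory.Simple V] (U : Submodule ℂ V) (hU : ∀ g, ∀ v ∈ U, V.ρ g v ∈ U) :
    U = ⊥ ∨ U = ⊤ := by
  let σ : Representation ℂ G U :=
    { toFun := fun g => (V.ρ g).restrict (hU g)
      map_one' := by ext v; simp
      map_mul' := fun a b => by ext v; simp }
  let f : FDRep.of σ ⟶ V :=
    { hom := FGModuleCat.ofHom U.subtype
      comm := fun g => by ext v; rfl }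
  have : CategoryTheory.Mono f := by
    apply CategoryTheory.ConcreteCategory.mono_of_injective
    intro a b hab
    exact Subtype.ext hab
  by_cases h0 : f = 0
  · left
    rw [Submodule.eq_bot_iff]
    intro v hv
    have h2 : f (⟨v, hv⟩ : U) = 0 := by
      rw [h0]; rfl
    exact h2
  · right
    have := CategoryTheory.isIso_of_mono_of_nonzero h0
    rw [eq_top_iff]
    intro v _
    obtain ⟨u, hu⟩ := (FDRep.isoToLinearEquiv (CategoryTheory.asIso f)).surjective v
    rw [← hu]
    exact u.2

/-- **The Gelfand trick**: if every double coset of `H` is closed under inversion, then an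
irreducible representation has at most a line of `H`-fixed vectors. -/
theorem Representation.finrank_invariants_le_one_of_inv_mem_doubleCoset {G V : Type*} [Group G]
    [AddCommGroup V] [Module ℂ V] [FiniteDimensional ℂ V] (ρ : Representation ℂ G V)
    (hρ : ∀ U : Submodule ℂ V, (∀ g, ∀ v ∈ U, ρ g v ∈ U) → U = ⊥ ∨ U = ⊤)
    (H : Subgroup G) [Finite H] (hH : ∀ g : G, ∃ a ∈ H, ∃ b ∈ H, g⁻¹ = a * g * b) :
    Module.finrank ℂ (invariants (ρ.comp H.subtype)) ≤ 1 := by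
  have := Fintype.ofFinite H
  set W := invariants (ρ.comp H.subtype) with hW
  have memW : ∀ v, v ∈ W ↔ ∀ h ∈ H, ρ h v = v := fun v => by
    simp [hW, Representation.mem_invariants]
  let N : V →ₗ[ℂ] V := ∑ h : H, ρ h
  have N_apply : ∀ v, N v = ∑ h : H, ρ h v := fun v => by simp [N]
  have ρ_N : ∀ h ∈ H, ∀ v, ρ h (N v) = N v := fun h hh v => by
    simp only [N_apply, map_sum, ← Module.End.mul_apply, ← map_mul]
    exact Fintype.sum_equiv (Equiv.mulLeft (⟨h, hh⟩ : H)) _ _ fun x => rfl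
  have N_ρ : ∀ h ∈ H, ∀ v, N (ρ h v) = N v := fun h hh v => by
    simp only [N_apply, ← Module.End.mul_apply, ← map_mul]
    exact Fintype.sum_equiv (Equiv.mulRight (⟨h, hh⟩ : H)) _ _ fun x => rfl
  have N_mem : ∀ v, N v ∈ W := fun v => (memW _).2 fun h hh => ρ_N h hh v
  have hc : (Fintype.card H : ℂ) ≠ 0 := by simp
  have N_W : ∀ w ∈ W, N w = (Fintype.card H : ℂ) • w := fun w hw => by
    have hfix : ∀ h : H, ρ h w = w := fun h => (memW w).1 hw h h.2
    simp [N_apply, hfix, Nat.cast_smul_eq_nsmul]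
  have N_inv : ∀ g, ∀ w ∈ W, N (ρ g⁻¹ w) = N (ρ g w) := fun g w hw => by
    obtain ⟨a, ha, b, hb, hab⟩ := hH g
    rw [hab, map_mul, map_mul, Module.End.mul_apply, Module.End.mul_apply, (memW w).1 hw b hb,
      N_ρ a ha]
  have expand : ∀ g g' w, N (ρ g (N (ρ g' w))) = ∑ h : H, N (ρ (g * h * g') w) :=
    fun g g' w => by
      rw [N_apply (ρ g' w)]
      simp [map_sum]
  have comm : ∀ g g', ∀ w ∈ W, N (ρ g (N (ρ g' w))) = N (ρ g' (N (ρ g w))) :=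
    fun g g' w hw => by
      rw [← N_inv g w hw, ← N_inv g' _ (N_mem _), expand, expand]
      refine Fintype.sum_equiv (Equiv.inv H) _ _ fun h => ?_
      rw [← N_inv _ w hw]
      simp [mul_assoc]
  have span_orbit : ∀ v ≠ 0, ∀ U : Submodule ℂ V, (∀ g, ρ g v ∈ U) → U = ⊤ := by
    intro v hv U hU
    have hs : Submodule.span ℂ (Set.range fun g => ρ g v) = ⊤ := by
      refine (hρ _ fun g x hx => ?_).resolve_left fun h => hv ?_
      · induction hx using Submodule.span_induction with
        | mem x hx =>
          obtain ⟨g', rfl⟩ := hx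
          exact Submodule.subset_span ⟨g * g', by simp⟩
        | zero => simp
        | add x y _ _ hx hy => rw [map_add]; exact add_mem hx hy
        | smul c x _ hx => rw [map_smul]; exact Submodule.smul_mem _ c hx
      · have : v ∈ Submodule.span ℂ (Set.range fun g => ρ g v) :=
          Submodule.subset_span ⟨1, by simp⟩
        rwa [h, Submodule.mem_bot] at this
    rw [eq_top_iff, ← hs, Submodule.span_le]
    rintro _ ⟨g, rfl⟩
    exact hU g
  rcases subsingleton_or_nontrivial W with hW0 | hW0
  · simp [Module.finrank_zero_of_subsingleton]
  have scalar : ∀ g, ∃ μ : ℂ, ∀ w ∈ W, N (ρ g w) = μ • w := by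
    intro g
    obtain ⟨μ, hμ⟩ := Module.End.exists_eigenvalue
      ((N ∘ₗ ρ g).restrict (p := W) (q := W) fun w _ => N_mem _)
    obtain ⟨⟨v, hvW⟩, hv⟩ := hμ.exists_hasEigenvector
    have hv0 : v ≠ 0 := fun h => hv.2 (Subtype.ext h)
    have hv1 : N (ρ g v) = μ • v := congrArg Subtype.val hv.apply_eq_smul
    refine ⟨μ, fun w hw => ?_⟩
    have key := span_orbit v hv0 (LinearMap.ker (N ∘ₗ ρ g ∘ₗ N - μ • N)) fun g' => by
      simp [comm g g' v hvW, hv1]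
    have hw' : w ∈ LinearMap.ker (N ∘ₗ ρ g ∘ₗ N - μ • N) := key ▸ Submodule.mem_top
    simp only [LinearMap.mem_ker, LinearMap.sub_apply, LinearMap.comp_apply,
      LinearMap.smul_apply, N_W w hw, map_smul, sub_eq_zero] at hw'
    rw [smul_comm] at hw'
    exact smul_right_injective _ hc hw'
  obtain ⟨⟨v, hvW⟩, hv⟩ := exists_ne (0 : W)
  have hv0 : v ≠ 0 := fun h => hv (Subtype.ext h)
  have key := span_orbit v hv0 ((Submodule.span ℂ {v}).comap N) fun g => by
    obtain ⟨μ, hμ⟩ := scalar g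
    rw [Submodule.mem_comap, hμ v hvW]
    exact Submodule.smul_mem _ _ (Submodule.mem_span_singleton_self v)
  refine finrank_le_one (⟨v, hvW⟩ : W) fun w => ?_
  have hw : (w : V) ∈ (Submodule.span ℂ {v}).comap N := key ▸ Submodule.mem_top
  rw [Submodule.mem_comap, N_W w w.2, Submodule.smul_mem_iff _ hc,
    Submodule.mem_span_singleton] at hw
  obtain ⟨c, hc⟩ := hw
  exact ⟨c, Subtype.ext hc⟩

/-- Two finite sets of the same size are exchanged by an involution. -/
theorem Finset.exists_involutive_perm_image_eq {α : Type*} [DecidableEq α] (A B : Finset α)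
    (h : A.card = B.card) :
    ∃ t : Equiv.Perm α, (∀ i, t (t i) = i) ∧ ∀ i, t i ∈ B ↔ i ∈ A := by
  have hcard : (A \ B).card = (B \ A).card := by
    have h1 := Finset.card_sdiff_add_card_inter A B
    have h2 := Finset.card_sdiff_add_card_inter B A
    rw [Finset.inter_comm] at h2
    omega
  let e := Finset.equivOfCardEq hcard
  let f : α → α := fun i =>
    if hA : i ∈ A \ B then e ⟨i, hA⟩ else if hB : i ∈ B \ A then e.symm ⟨i, hB⟩ else i
  have fA : ∀ i (hA : i ∈ A \ B), f i = e ⟨i, hA⟩ := fun i hA => dif_pos hA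
  have fB : ∀ i (hB : i ∈ B \ A), f i = e.symm ⟨i, hB⟩ := fun i hB => by
    have hA : i ∉ A \ B := fun hA => by simp_all
    simp only [f, dif_neg hA, dif_pos hB]
  have fC : ∀ i, i ∉ A \ B → i ∉ B \ A → f i = i := fun i hA hB => by
    simp only [f, dif_neg hA, dif_neg hB]
  have hf : Function.Involutive f := fun i => by
    by_cases hA : i ∈ A \ B
    · rw [fA i hA, fB _ (e ⟨i, hA⟩).2]
      simp
    by_cases hB : i ∈ B \ A
    · rw [fB i hB, fA _ (e.symm ⟨i, hB⟩).2]
      simp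
    rw [fC i hA hB, fC i hA hB]
  refine ⟨hf.toPerm, hf, fun i => ?_⟩
  change f i ∈ B ↔ i ∈ A
  by_cases hA : i ∈ A \ B
  · rw [fA i hA]
    exact iff_of_true (Finset.mem_sdiff.1 (e ⟨i, hA⟩).2).1 (Finset.mem_sdiff.1 hA).1
  by_cases hB : i ∈ B \ A
  · rw [fB i hB]
    exact iff_of_false (Finset.mem_sdiff.1 (e.symm ⟨i, hB⟩).2).2 (Finset.mem_sdiff.1 hB).2
  rw [fC i hA hB]
  simp only [Finset.mem_sdiff] at hA hB
  tauto

theorem Equiv.Perm.mul_swap_mul_self {α : Type*} [DecidableEq α]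
    {t : Equiv.Perm α} (ht : t * t = 1) (i j : α) :
    t * Equiv.swap i j * t = Equiv.swap (t i) (t j) := by
  have ht' : t⁻¹ = t := inv_eq_of_mul_eq_one_right ht
  rw [Equiv.swap_apply_apply, ht']

section Block

variable {α : Type*} {p : α → Prop}

theorem swap_mem_blockStab [DecidableEq α] {i j : α} (h : p i ↔ p j) :
    Equiv.swap i j ∈ blockStab p := by
  intro l
  rcases eq_or_ne l i with rfl | hi
  · simpa using h
  rcases eq_or_ne l j with rfl | hj
  · simpa using h.symm
  rw [Equiv.swap_apply_of_ne_of_ne hi hj]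

/-- A permutation is an involution times a block-preserving permutation. -/
theorem exists_involutive_mul_mem_blockStab [Finite α] (p : α → Prop) (g : Equiv.Perm α) :
    ∃ t : Equiv.Perm α, t * t = 1 ∧ ∃ b ∈ blockStab p, g = t * b := by
  classical
  have := Fintype.ofFinite α
  let A : Finset α := {i | p i}
  obtain ⟨t, ht, htA⟩ := Finset.exists_involutive_perm_image_eq (A.map g.toEmbedding) A (by simp)
  have htt : t * t = 1 := Equiv.ext ht
  refine ⟨t, htt, t * g, fun i => ?_, by rw [← mul_assoc, htt, one_mul]⟩
  have := htA (g i)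
  simp [A] at this
  simpa using this.symm

/-- Double cosets of the kernel of a sign-valued character `χ` of a block stabilizer are closed
under inversion, provided each involution conjugates some element on which `χ` is nontrivial to another such
element of the stabilizer. -/
theorem inv_mem_doubleCoset_of_character [Finite α] (χ : blockStab p →* ℤˣ)
    (hχ : ∀ t : Equiv.Perm α, t * t = 1 → ∃ x y : blockStab p,
      χ x = -1 ∧ χ y = -1 ∧ t * x * t = y)
    (g : Equiv.Perm α) :
    ∃ a ∈ χ.ker.map (blockStab p).subtype, ∃ b ∈ χ.ker.map (blockStab p).subtype,
      g⁻¹ = a * g * b := by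
  obtain ⟨t, ht, b, hb, rfl⟩ := exists_involutive_mul_mem_blockStab p g
  have ht' : t⁻¹ = t := inv_eq_of_mul_eq_one_right ht
  have ht2 : ∀ z, t * (t * z) = z := fun z => by rw [← mul_assoc, ht, one_mul]
  lift b to blockStab p using hb
  rcases Int.units_eq_one_or (χ b) with h | h
  · refine ⟨_, ⟨b⁻¹, by simp [MonoidHom.mem_ker, h], rfl⟩,
      _, ⟨b⁻¹, by simp [MonoidHom.mem_ker, h], rfl⟩, ?_⟩
    simp [ht', mul_assoc]
  · obtain ⟨x, y, hx, hy, hxy⟩ := hχ t ht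
    refine ⟨_, ⟨b⁻¹ * x, by simp [MonoidHom.mem_ker, h, hx], rfl⟩,
      _, ⟨b⁻¹ * y⁻¹, by simp [MonoidHom.mem_ker, h, hy], rfl⟩, ?_⟩
    simp [← hxy, ht', mul_assoc, ht2]

/-- Among three elements of the block, some two behave alike under `t`. -/
theorem exists_ne_alike (t : α → α) (f : Fin 3 → α) (hf : Function.Injective f)
    (hp : ∀ i, p (f i)) :
    ∃ i j, i ≠ j ∧ p i ∧ p j ∧ (p (t i) ↔ p (t j)) := by
  classical
  obtain ⟨a, b, hab, h⟩ := Fintype.exists_ne_map_eq_of_card_lt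
    (fun i => decide (p (t (f i)))) (by simp)
  exact ⟨f a, f b, hf.ne hab, hp a, hp b, by simpa using h⟩

/-- Two elements of `s` that `t` maps both into `s` or both out of `s` yield an element of the
stabilizer fit for `inv_mem_doubleCoset_of_character`. -/
theorem exists_conj_of_alike [DecidableEq α] (χ : blockStab p →* ℤˣ) (s : α → Prop)
    (hs : ∀ i j, s i → s j → (p i ↔ p j)) (hs' : ∀ i j, ¬ s i → ¬ s j → (p i ↔ p j))
    (hpos : ∀ i j, i ≠ j → ∀ (hi : s i) (hj : s j),
      χ ⟨Equiv.swap i j, swap_mem_blockStab (hs i j hi hj)⟩ = -1)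
    (hneg : ∀ i j, ∀ (hi : ¬ s i) (hj : ¬ s j),
      χ ⟨Equiv.swap i j, swap_mem_blockStab (hs' i j hi hj)⟩ = 1)
    (f : Fin 3 → α) (hf : Function.Injective f) (hp : ∀ i, s (f i))
    (t : Equiv.Perm α) (ht : t * t = 1) :
    ∃ x y : blockStab p, χ x = -1 ∧ χ y = -1 ∧ t * x * t = y := by
  obtain ⟨i, j, hij, hi, hj, h⟩ := exists_ne_alike t f hf hp
  by_cases hti : s (t i)
  · exact ⟨_, _, hpos i j hij hi hj, hpos (t i) (t j) (t.injective.ne hij) hti (h.1 hti),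
      Equiv.Perm.mul_swap_mul_self ht i j⟩
  · have htj : ¬ s (t j) := fun hj => hti (h.2 hj)
    let u : blockStab p := ⟨Equiv.swap i j, swap_mem_blockStab (hs i j hi hj)⟩
    let v : blockStab p := ⟨Equiv.swap (t i) (t j), swap_mem_blockStab (hs' _ _ hti htj)⟩
    have hu : χ u = -1 := hpos i j hij hi hj
    have hv : χ v = 1 := hneg _ _ hti htj
    refine ⟨u * v, v * u, by rw [map_mul, hu, hv, mul_one], by rw [map_mul, hu, hv, one_mul], ?_⟩
    have h1 : t * u * t = v := Equiv.Perm.mul_swap_mul_self ht i j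
    have h2 : t * v * t = u := by
      rw [← h1]
      simp only [← mul_assoc, ht, one_mul]
      rw [mul_assoc, ht, mul_one]
    calc t * ((u * v : blockStab p) : Equiv.Perm α) * t
        = (t * u * t) * (t * v * t) := by
          simp only [Subgroup.coe_mul, mul_assoc]
          rw [← mul_assoc t t, ht, one_mul]
      _ = _ := by rw [h1, h2]; rfl

variable [Fintype α] [DecidableEq α] [DecidablePred p]

/-- The sign of the restriction to the block. -/
def blockSign (p : α → Prop) [DecidablePred p] : blockStab p →* ℤˣ :=
  Equiv.Perm.sign.comp (restrictBlock p)

/-- The sign of the restriction to the complementary block. -/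
def coblockSign (p : α → Prop) [DecidablePred p] : blockStab p →* ℤˣ :=
  Equiv.Perm.sign.comp (restrictCoblock p)

theorem sign_subtypePerm_swap_of_pos (q : α → Prop) [DecidablePred q] {i j : α} (hij : i ≠ j)
    (hi : q i) (hj : q j) (h : ∀ x, q (Equiv.swap i j x) ↔ q x) :
    Equiv.Perm.sign ((Equiv.swap i j).subtypePerm h) = -1 := by
  rw [Equiv.Perm.sign_subtypePerm, Equiv.Perm.sign_swap hij]
  intro x hx
  by_contra hq
  exact hx (Equiv.swap_apply_of_ne_of_ne (by rintro rfl; exact hq hi) (by rintro rfl; exact hq hj))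

theorem sign_subtypePerm_swap_of_neg (q : α → Prop) [DecidablePred q] {i j : α}
    (hi : ¬ q i) (hj : ¬ q j) (h : ∀ x, q (Equiv.swap i j x) ↔ q x) :
    Equiv.Perm.sign ((Equiv.swap i j).subtypePerm h) = 1 := by
  convert Equiv.Perm.sign_one
  ext ⟨x, hx⟩
  exact Equiv.swap_apply_of_ne_of_ne (by rintro rfl; exact hi hx) (by rintro rfl; exact hj hx)

theorem blockSign_swap_of_pos {i j : α} (hij : i ≠ j) (hi : p i) (hj : p j) :
    blockSign p ⟨Equiv.swap i j, swap_mem_blockStab (iff_of_true hi hj)⟩ = -1 :=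
  sign_subtypePerm_swap_of_pos p hij hi hj
    fun x => (swap_mem_blockStab (iff_of_true hi hj) x).symm

theorem blockSign_swap_of_neg {i j : α} (hi : ¬ p i) (hj : ¬ p j) :
    blockSign p ⟨Equiv.swap i j, swap_mem_blockStab (iff_of_false hi hj)⟩ = 1 :=
  sign_subtypePerm_swap_of_neg p hi hj
    fun x => (swap_mem_blockStab (iff_of_false hi hj) x).symm

theorem coblockSign_swap_of_pos {i j : α} (hi : p i) (hj : p j) :
    coblockSign p ⟨Equiv.swap i j, swap_mem_blockStab (iff_of_true hi hj)⟩ = 1 :=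
  sign_subtypePerm_swap_of_neg (fun i => ¬ p i) (not_not.2 hi) (not_not.2 hj)
    fun x => not_congr (swap_mem_blockStab (iff_of_true hi hj) x).symm

theorem coblockSign_swap_of_neg {i j : α} (hij : i ≠ j) (hi : ¬ p i) (hj : ¬ p j) :
    coblockSign p ⟨Equiv.swap i j, swap_mem_blockStab (iff_of_false hi hj)⟩ = -1 :=
  sign_subtypePerm_swap_of_pos (fun i => ¬ p i) hij hi hj
    fun x => not_congr (swap_mem_blockStab (iff_of_false hi hj) x).symm

theorem exists_conj_blockSign (f : Fin 3 → α) (hf : Function.Injective f) (hp : ∀ i, p (f i))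
    (t : Equiv.Perm α) (ht : t * t = 1) :
    ∃ x y : blockStab p, blockSign p x = -1 ∧ blockSign p y = -1 ∧ t * x * t = y :=
  exists_conj_of_alike _ p (fun _ _ => iff_of_true) (fun _ _ => iff_of_false)
    (fun _ _ hij hi hj => blockSign_swap_of_pos hij hi hj)
    (fun _ _ hi hj => blockSign_swap_of_neg hi hj) f hf hp t ht

theorem exists_conj_coblockSign (f : Fin 3 → α) (hf : Function.Injective f)
    (hp : ∀ i, ¬ p (f i)) (t : Equiv.Perm α) (ht : t * t = 1) :
    ∃ x y : blockStab p, coblockSign p x = -1 ∧ coblockSign p y = -1 ∧ t * x * t = y :=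
  exists_conj_of_alike _ (fun i => ¬ p i) (fun _ _ => iff_of_false)
    (fun _ _ hi hj => iff_of_true (not_not.1 hi) (not_not.1 hj))
    (fun _ _ hij hi hj => coblockSign_swap_of_neg hij hi hj)
    (fun _ _ hi hj => coblockSign_swap_of_pos (not_not.1 hi) (not_not.1 hj)) f hf hp t ht

theorem exists_conj_blockSign_mul_coblockSign (f : Fin 3 → α) (hf : Function.Injective f)
    (hp : ∀ i, p (f i)) (t : Equiv.Perm α) (ht : t * t = 1) :
    ∃ x y : blockStab p, (blockSign p * coblockSign p) x = -1 ∧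
      (blockSign p * coblockSign p) y = -1 ∧ t * x * t = y := by
  obtain ⟨i, j, hij, hi, hj, h⟩ := exists_ne_alike t f hf hp
  refine ⟨⟨_, swap_mem_blockStab (iff_of_true hi hj)⟩, ⟨_, swap_mem_blockStab h⟩, ?_, ?_,
    Equiv.Perm.mul_swap_mul_self ht i j⟩
  · simp [blockSign_swap_of_pos hij hi hj, coblockSign_swap_of_pos hi hj]
  · have hij' := t.injective.ne hij
    by_cases hti : p (t i)
    · simp [blockSign_swap_of_pos hij' hti (h.1 hti), coblockSign_swap_of_pos hti (h.1 hti)]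
    · have htj := mt h.2 hti
      simp [blockSign_swap_of_neg hti htj, coblockSign_swap_of_neg hij' hti htj]

theorem mem_evenEven_coe {b : blockStab p} :
    (b : Equiv.Perm α) ∈ evenEven p ↔ blockSign p b = 1 ∧ coblockSign p b = 1 := by
  simp only [evenEven, Subgroup.mem_map_iff_mem (blockStab p).subtype_injective,
    ← Subgroup.subtype_apply, Subgroup.mem_inf, MonoidHom.mem_ker]
  rfl

/-- A subgroup of the block stabilizer strictly containing `evenEven p` contains the kernel of one
of the three nontrivial sign characters. -/
theorem exists_ker_le_of_evenEven_lt {G : Subgroup (Equiv.Perm α)} (h : evenEven p < G)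
    (hG : G ≤ blockStab p) :
    ∃ χ : blockStab p →* ℤˣ,
      (χ = blockSign p ∨ χ = coblockSign p ∨ χ = blockSign p * coblockSign p) ∧
      χ.ker.map (blockStab p).subtype ≤ G := by
  obtain ⟨hle, y, hyG, hy⟩ := SetLike.lt_iff_le_and_exists.1 h
  lift y to blockStab p using hG hyG
  have key : ∀ x : blockStab p, blockSign p x = blockSign p y →
      coblockSign p x = coblockSign p y → (x : Equiv.Perm α) ∈ G := fun x h1 h2 => by
    have : ((x * y⁻¹ : blockStab p) : Equiv.Perm α) ∈ G :=
      hle (mem_evenEven_coe.2 (by simp [h1, h2]))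
    simpa using mul_mem this hyG
  have key1 : ∀ x : blockStab p, blockSign p x = 1 → coblockSign p x = 1 →
      (x : Equiv.Perm α) ∈ G := fun x h1 h2 => hle (mem_evenEven_coe.2 ⟨h1, h2⟩)
  rw [mem_evenEven_coe] at hy
  rcases Int.units_eq_one_or (blockSign p y) with h1 | h1 <;>
  rcases Int.units_eq_one_or (coblockSign p y) with h2 | h2
  · exact absurd ⟨h1, h2⟩ hy
  · refine ⟨_, Or.inl rfl, ?_⟩
    rintro _ ⟨x, hx, rfl⟩
    have hx : blockSign p x = 1 := hx
    rcases Int.units_eq_one_or (coblockSign p x) with h3 | h3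
    · exact key1 x hx h3
    · exact key x (hx.trans h1.symm) (h3.trans h2.symm)
  · refine ⟨_, Or.inr (Or.inl rfl), ?_⟩
    rintro _ ⟨x, hx, rfl⟩
    have hx : coblockSign p x = 1 := hx
    rcases Int.units_eq_one_or (blockSign p x) with h3 | h3
    · exact key1 x h3 hx
    · exact key x (h3.trans h1.symm) (hx.trans h2.symm)
  · refine ⟨_, Or.inr (Or.inr rfl), ?_⟩
    rintro _ ⟨x, hx, rfl⟩
    have hx : blockSign p x * coblockSign p x = 1 := hx
    rcases Int.units_eq_one_or (blockSign p x) with h3 | h3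
    · exact key1 x h3 (by simpa [h3] using hx)
    · exact key x (h3.trans h1.symm) (by simpa [h3, h2, neg_eq_iff_eq_neg] using hx)

end Block

theorem stmt6 (k : ℕ) (hk : 10 ≤ k) :
    ∀ G : Subgroup (Equiv.Perm (Fin (2 * k + 1))),
      evenEven (fun i : Fin (2 * k + 1) => (i : ℕ) < k + 1) < G →
      G ≤ blockStab (fun i : Fin (2 * k + 1) => (i : ℕ) < k + 1) →
      IsMultFree G := by
  intro G hlt hG V hV
  refine Representation.finrank_invariants_le_one_of_inv_mem_doubleCoset V.ρ
    (fun U hU => FDRep.eq_bot_or_eq_top_of_simple V U hU) G fun g => ?_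
  obtain ⟨χ, hχ, hker⟩ := exists_ker_le_of_evenEven_lt hlt hG
  let f : Fin 3 → Fin (2 * k + 1) := fun i => ⟨i, by omega⟩
  let f' : Fin 3 → Fin (2 * k + 1) := fun i => ⟨k + 1 + i, by omega⟩
  have hf : Function.Injective f := fun i j h => by simpa [f, Fin.ext_iff] using h
  have hf' : Function.Injective f' := fun i j h => by simpa [f', Fin.ext_iff] using h
  have hp : ∀ i, (f i : ℕ) < k + 1 := fun i => by simp only [f]; omega
  have hp' : ∀ i, ¬ (f' i : ℕ) < k + 1 := fun i => by simp only [f']; omega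
  obtain ⟨a, ha, b, hb, hab⟩ := inv_mem_doubleCoset_of_character χ (by
    rcases hχ with rfl | rfl | rfl
    · exact exists_conj_blockSign f hf hp
    · exact exists_conj_coblockSign f' hf' hp'
    · exact exists_conj_blockSign_mul_coblockSign f hf hp) g
  exact ⟨a, hker ha, b, hker hb, hab⟩
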